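/- arXiv:math/0609390 — 3 statements merged into one kernel-verified Lean document; each statement's English description precedes it below -/
import Mathlib

section
/- M is a Poisson module over the Poisson algebra R: (1) (M,·) is a module over the commutative algebra R; (2) (M,{·,·}_M) is a right module over the Lie algebra (R,{·,·}), i.e. {{m,a}_M, b}_M − {{m,b}_M, a}_M = {m,{a,b}}_M for all a,b ∈ R, m ∈ M; (3) m·{a,b} = {m,a}_M·b − {m·b, a}_M for all a,b ∈ R, m ∈ M; (4) {m, ab}_M = {m,a}_M·b + {m,b}_M·a for all a,b ∈ R, m ∈ M. -/
open MvPolynomial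

/-! Context: `R = ℂ[X_1,…,X_n]` with the Poisson bracket `{f,g}`, the unique
skew-symmetric biderivation with `{X i, X j} = a i j • X i * X j`, realized by the
explicit formula `{f,g} = ∑ i j, a i j * X i * X j * ∂f/∂X i * ∂g/∂X j`.
`M` is `R` as a module over itself via multiplication, with bracket
`{m, f}_M = -{f, m} + D f * m`, where `D` is the ℂ-linear derivation with
`D (X i) = (∑ l, a i l) • X i`. -/

/-- The Poisson bracket on `ℂ[X_1,…,X_n]` with `{X i, X j} = a i j • X i X j`. -/
noncomputable def pb {n : ℕ} (a : Fin n → Fin n → ℤ)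
    (f g : MvPolynomial (Fin n) ℂ) : MvPolynomial (Fin n) ℂ :=
  ∑ i : Fin n, ∑ j : Fin n,
    C ((a i j : ℂ)) * X i * X j * pderiv i f * pderiv j g

/-- The derivation `D` of `ℂ[X_1,…,X_n]` with `D (X i) = (∑ l, a i l) • X i`. -/
noncomputable def Dpoly {n : ℕ} (a : Fin n → Fin n → ℤ)
    (f : MvPolynomial (Fin n) ℂ) : MvPolynomial (Fin n) ℂ :=
  ∑ i : Fin n, C ((∑ l : Fin n, (a i l : ℂ))) * X i * pderiv i f

/-- The bracket `{·,·}_M : M × R → M` of the Poisson module `M`. -/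
noncomputable def bM {n : ℕ} (a : Fin n → Fin n → ℤ)
    (m f : MvPolynomial (Fin n) ℂ) : MvPolynomial (Fin n) ℂ :=
  - pb a f m + Dpoly a f * m

theorem Derivation.finset_sum_apply {ι R A M : Type*} [CommSemiring R] [CommSemiring A]
    [AddCommMonoid M] [Algebra R A] [Module A M] [Module R M] (s : Finset ι)
    (D : ι → Derivation R A M) (x : A) : (∑ i ∈ s, D i) x = ∑ i ∈ s, D i x := by
  rw [← Derivation.coeFnAddMonoidHom_apply, map_sum, Finset.sum_apply]
  rfl

/-- The derivation of a polynomial ring which scales the variable `X i` by `c i`. -/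
noncomputable def diagDer {n : ℕ} (c : Fin n → ℂ) :
    Derivation ℂ (MvPolynomial (Fin n) ℂ) (MvPolynomial (Fin n) ℂ) :=
  mkDerivation ℂ fun i => C (c i) * X i

theorem diagDer_X {n : ℕ} (c : Fin n → ℂ) (i : Fin n) : diagDer c (X i) = C (c i) * X i :=
  mkDerivation_X _ _ _

theorem diagDer_C {n : ℕ} (c : Fin n → ℂ) (r : ℂ) : diagDer c (C r) = 0 :=
  (diagDer c).map_algebraMap r

theorem diagDer_apply {n : ℕ} (c : Fin n → ℂ) (f : MvPolynomial (Fin n) ℂ) :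
    diagDer c f = ∑ i, C (c i) * X i * pderiv i f := by
  have h : diagDer c = ∑ i, (C (c i) * X i : MvPolynomial (Fin n) ℂ) • pderiv i := by
    refine derivation_ext fun k => ?_
    rw [diagDer_X, Derivation.finset_sum_apply]
    simp [pderiv_X, Pi.single_apply]
  rw [h, Derivation.finset_sum_apply]
  simp

theorem diagDer_single {n : ℕ} (i : Fin n) (f : MvPolynomial (Fin n) ℂ) :
    diagDer (Pi.single i 1) f = X i * pderiv i f := by
  rw [diagDer_apply, Finset.sum_eq_single i]
  · simp
  · intro j _ hj
    simp [hj]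
  · simp

theorem diagDer_comm {n : ℕ} (c d : Fin n → ℂ) (f : MvPolynomial (Fin n) ℂ) :
    diagDer c (diagDer d f) = diagDer d (diagDer c f) := by
  have h : ⁅diagDer c, diagDer d⁆ = 0 := by
    refine derivation_ext fun k => ?_
    simp only [Derivation.commutator_apply, diagDer_X, Derivation.leibniz, diagDer_C,
      smul_eq_mul, Derivation.coe_zero, Pi.zero_apply]
    ring
  have h' := DFunLike.congr_fun h f
  rwa [Derivation.commutator_apply, Derivation.coe_zero, Pi.zero_apply, sub_eq_zero] at h'

theorem Dpoly_eq_diagDer {n : ℕ} (a : Fin n → Fin n → ℤ) (f : MvPolynomial (Fin n) ℂ) :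
    Dpoly a f = diagDer (fun i => ∑ l, (a i l : ℂ)) f :=
  (diagDer_apply _ f).symm

theorem pb_eq_sum_diagDer {n : ℕ} (a : Fin n → Fin n → ℤ) (f g : MvPolynomial (Fin n) ℂ) :
    pb a f g = ∑ i, ∑ j, C (a i j : ℂ) *
      (diagDer (Pi.single i 1) f * diagDer (Pi.single j 1) g) := by
  refine Finset.sum_congr rfl fun i _ => Finset.sum_congr rfl fun j _ => ?_
  rw [diagDer_single, diagDer_single]
  ring

theorem diagDer_pb {n : ℕ} (a : Fin n → Fin n → ℤ) (c : Fin n → ℂ)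
    (f g : MvPolynomial (Fin n) ℂ) :
    diagDer c (pb a f g) = pb a (diagDer c f) g + pb a f (diagDer c g) := by
  simp only [pb_eq_sum_diagDer, map_sum, ← Finset.sum_add_distrib]
  refine Finset.sum_congr rfl fun i _ => Finset.sum_congr rfl fun j _ => ?_
  simp only [Derivation.leibniz, diagDer_C, smul_eq_mul]
  rw [diagDer_comm c (Pi.single i 1), diagDer_comm c (Pi.single j 1)]
  ring

theorem pb_skew {n : ℕ} {a : Fin n → Fin n → ℤ} (ha : ∀ i j, a j i = - a i j)
    (f g : MvPolynomial (Fin n) ℂ) : pb a f g = - pb a g f := by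
  unfold pb
  rw [Finset.sum_comm, ← Finset.sum_neg_distrib]
  refine Finset.sum_congr rfl fun i _ => ?_
  rw [← Finset.sum_neg_distrib]
  refine Finset.sum_congr rfl fun j _ => ?_
  rw [ha i j, Int.cast_neg, C_neg]
  ring

/-- The Hamiltonian derivation `{f, ·}`. -/
noncomputable def hamiltonian {n : ℕ} (a : Fin n → Fin n → ℤ) (f : MvPolynomial (Fin n) ℂ) :
    Derivation ℂ (MvPolynomial (Fin n) ℂ) (MvPolynomial (Fin n) ℂ) :=
  ∑ i, ∑ j, (C (a i j : ℂ) * X i * X j * pderiv i f) • pderiv j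

theorem hamiltonian_apply {n : ℕ} (a : Fin n → Fin n → ℤ) (f g : MvPolynomial (Fin n) ℂ) :
    hamiltonian a f g = pb a f g := by
  simp only [hamiltonian, pb, Derivation.finset_sum_apply, Derivation.coe_smul,
    Pi.smul_apply, smul_eq_mul]

theorem hamiltonian_X {n : ℕ} (a : Fin n → Fin n → ℤ) (f : MvPolynomial (Fin n) ℂ)
    (k : Fin n) : hamiltonian a f (X k) = diagDer (fun i => (a i k : ℂ)) f * X k := by
  rw [hamiltonian_apply, pb, diagDer_apply, Finset.sum_mul]
  refine Finset.sum_congr rfl fun i _ => ?_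
  rw [Finset.sum_eq_single k]
  · rw [pderiv_X_self]
    ring
  · intro j _ hj
    rw [pderiv_X_of_ne hj.symm, mul_zero]
  · simp

theorem hamiltonian_pb {n : ℕ} {a : Fin n → Fin n → ℤ} (ha : ∀ i j, a j i = - a i j)
    (f g : MvPolynomial (Fin n) ℂ) :
    hamiltonian a (pb a f g) = ⁅hamiltonian a f, hamiltonian a g⁆ := by
  refine derivation_ext fun k => ?_
  rw [Derivation.commutator_apply]
  simp only [hamiltonian_X, Derivation.leibniz, smul_eq_mul, diagDer_pb]
  simp only [hamiltonian_apply]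
  rw [pb_skew ha (diagDer _ f) g]
  ring

theorem pb_jacobi {n : ℕ} {a : Fin n → Fin n → ℤ} (ha : ∀ i j, a j i = - a i j)
    (f g m : MvPolynomial (Fin n) ℂ) :
    pb a (pb a f g) m = pb a f (pb a g m) - pb a g (pb a f m) := by
  simpa only [Derivation.commutator_apply, hamiltonian_apply] using
    DFunLike.congr_fun (hamiltonian_pb ha f g) m

theorem pb_mul_right {n : ℕ} (a : Fin n → Fin n → ℤ) (f g h : MvPolynomial (Fin n) ℂ) :
    pb a f (g * h) = g * pb a f h + h * pb a f g := by
  simp only [← hamiltonian_apply, Derivation.leibniz, smul_eq_mul]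

/-- `M` is a Poisson module over the Poisson algebra `R`:
(1) `(M, ·)` is a module over the commutative algebra `R` (the action being
multiplication); (2) `(M, {·,·}_M)` is a right module over the Lie algebra
`(R, {·,·})`; (3) `m·{f,g} = {m,f}_M·g − {m·g, f}_M`; (4) `{m, fg}_M = {m,f}_M·g + {m,g}_M·f`. -/
theorem M_is_poisson_module
    (n : ℕ) (hn : 1 ≤ n) (a : Fin n → Fin n → ℤ)
    (ha : ∀ i j, a j i = - a i j) :
    -- (1) (M, ·) is a (right) module over the commutative algebra R
    ((∀ m f g : MvPolynomial (Fin n) ℂ, m * (f * g) = (m * f) * g) ∧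
      (∀ m : MvPolynomial (Fin n) ℂ, m * 1 = m) ∧
      (∀ m m' f : MvPolynomial (Fin n) ℂ, (m + m') * f = m * f + m' * f) ∧
      (∀ m f g : MvPolynomial (Fin n) ℂ, m * (f + g) = m * f + m * g)) ∧
    -- (2) (M, {·,·}_M) is a (right) module over the Lie algebra (R, {·,·})
    (∀ (f g : MvPolynomial (Fin n) ℂ) (m : MvPolynomial (Fin n) ℂ),
      bM a (bM a m f) g - bM a (bM a m g) f = bM a m (pb a f g)) ∧
    -- (3)
    (∀ (f g : MvPolynomial (Fin n) ℂ) (m : MvPolynomial (Fin n) ℂ),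
      m * pb a f g = bM a m f * g - bM a (m * g) f) ∧
    -- (4)
    (∀ (f g : MvPolynomial (Fin n) ℂ) (m : MvPolynomial (Fin n) ℂ),
      bM a m (f * g) = bM a m f * g + bM a m g * f) := by
  refine ⟨⟨fun m f g => (mul_assoc m f g).symm, mul_one, add_mul, mul_add⟩, ?_, ?_, ?_⟩
  · intro f g m
    have expand (u v w : MvPolynomial (Fin n) ℂ) :
        pb a u (-v + w * m) = - pb a u v + (w * pb a u m + m * pb a u w) := by
      rw [← pb_mul_right]
      simp only [← hamiltonian_apply, map_add, map_neg]
    simp only [bM, expand, pb_jacobi ha, Dpoly_eq_diagDer, diagDer_pb]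
    rw [pb_skew ha (diagDer _ f) g]
    ring
  · intro f g m
    simp only [bM, pb_mul_right]
    ring
  · intro f g m
    simp only [bM, Dpoly_eq_diagDer, Derivation.leibniz, smul_eq_mul]
    rw [pb_skew ha (f * g) m, pb_mul_right, pb_skew ha f m, pb_skew ha g m]
    ring
end

section
/- Let 0 ≤ k ≤ n−1. Let S_{k+1,n−k−1} be the set of permutations σ of {1,…,n} with σ(1)<⋯<σ(k+1) and σ(k+2)<⋯<σ(n), and let S_{k,1,n−k−1} be the set of permutations τ of {1,…,n} with τ(1)<⋯<τ(k) and τ(k+2)<⋯<τ(n). Then the map sending (σ,i) ∈ S_{k+1,n−k−1} × {1,…,k+1} to τ = σ ∘ (i, i+1, …, k+1) (composition with the cycle sending i ↦ i+1 ↦ ⋯ ↦ k+1 ↦ i) is a well-defined bijection onto S_{k,1,n−k−1}, and the signs satisfy ε(τ) = (−1)^{k+1−i} ε(σ). In particular both sets have cardinality (n choose k)·(n−k). -/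
open Equiv

/-! Statement 4.  We use 0-based positions: a permutation `σ` of `{1,…,n}` becomes a
permutation of `Fin n`, the 1-based position `r` becoming `r - 1 : Fin n`, and the
1-based index `i ∈ {1,…,k+1}` becoming `i - 1 : Fin (k+1)`.
`S_{k+1,n-k-1}` is the set of `σ` increasing on positions `0,…,k` and on positions
`k+1,…,n-1`; `S_{k,1,n-k-1}` is the set of `τ` increasing on positions `0,…,k-1` and on
positions `k+1,…,n-1`.  The cycle `(i, i+1, …, k+1)` (1-based) is the `formPerm` of the
list of positions `i-1, i, …, k` (0-based). -/

/-- The cyclic permutation sending (0-based) position `i` to `i+1`, …, `k-1` to `k`,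
and `k` to `i`; i.e. the cycle `(i+1, i+2, …, k+1)` in 1-based notation. -/
def cyc4 (n k : ℕ) (i : Fin (k + 1)) : Equiv.Perm (Fin n) :=
  ((List.finRange n).filter (fun x : Fin n => decide ((i : ℕ) ≤ (x : ℕ) ∧ (x : ℕ) ≤ k))).formPerm

/-- `S_{k+1,n-k-1}` (0-based positions). -/
def S₄big (n k : ℕ) : Set (Equiv.Perm (Fin n)) :=
  {σ | (∀ p q : Fin n, p < q → (q : ℕ) ≤ k → σ p < σ q) ∧
       (∀ p q : Fin n, p < q → k + 1 ≤ (p : ℕ) → σ p < σ q)}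

/-- `S_{k,1,n-k-1}` (0-based positions). -/
def S₄mid (n k : ℕ) : Set (Equiv.Perm (Fin n)) :=
  {τ | (∀ p q : Fin n, p < q → (q : ℕ) < k → τ p < τ q) ∧
       (∀ p q : Fin n, p < q → k + 1 ≤ (p : ℕ) → τ p < τ q)}

/-- The list of positions in `cyc4` is `i, i+1, …, k`. -/
theorem filter_finRange_eq_ofFn {n k i : ℕ} (hk : k < n) :
    (List.finRange n).filter (fun x : Fin n => decide (i ≤ (x : ℕ) ∧ (x : ℕ) ≤ k)) =
      List.ofFn (fun j : Fin (k + 1 - i) => (⟨i + j, by omega⟩ : Fin n)) := by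
  have h₁ : ((List.finRange n).filter
      (fun x : Fin n => decide (i ≤ (x : ℕ) ∧ (x : ℕ) ≤ k))).SortedLT :=
    ((List.sortedLT_finRange n).pairwise.filter _).sortedLT
  have h₂ : (List.ofFn (fun j : Fin (k + 1 - i) => (⟨i + j, by omega⟩ : Fin n))).SortedLT := by
    rw [List.sortedLT_ofFn_iff]
    intro a b hab
    simpa using hab
  refine h₁.eq_of_mem_iff h₂ fun x => ?_
  simp only [List.mem_filter, List.mem_finRange, true_and, decide_eq_true_eq, List.mem_ofFn]
  constructor
  · rintro ⟨h, h'⟩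
    exact ⟨⟨x - i, by omega⟩, Fin.ext (by simp; omega)⟩
  · rintro ⟨j, rfl⟩
    have := j.2
    simp
    omega

theorem cyc4_apply_val {n k : ℕ} (hk : k < n) (i : Fin (k + 1)) (x : Fin n) :
    (cyc4 n k i x : ℕ) =
      if (x : ℕ) < i then (x : ℕ) else if (x : ℕ) < k then x + 1 else
        if (x : ℕ) = k then (i : ℕ) else x := by
  have hi := i.2
  rw [cyc4, filter_finRange_eq_ofFn hk]
  set L := List.ofFn (fun j : Fin (k + 1 - i) => (⟨i + j, by omega⟩ : Fin n)) with hL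
  by_cases hx : (i : ℕ) ≤ x ∧ (x : ℕ) ≤ k
  · have hnd : L.Nodup := by
      rw [hL, List.nodup_ofFn]
      intro a b hab
      simpa [Fin.ext_iff] using hab
    have hlen : L.length = k + 1 - i := by simp [hL]
    have hlt : (x : ℕ) - i < L.length := by omega
    have hget : L[(x : ℕ) - i] = x := by
      simp only [hL, List.getElem_ofFn]
      exact Fin.ext (by simp; omega)
    have key := List.formPerm_apply_getElem L hnd ((x : ℕ) - i) hlt
    rw [hget] at key
    rw [key]
    simp only [hL, List.getElem_ofFn, List.length_ofFn]
    rcases hx.2.lt_or_eq with h | h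
    · rw [Nat.mod_eq_of_lt (by omega)]
      split_ifs <;> omega
    · rw [show (x : ℕ) - i + 1 = k + 1 - i by omega, Nat.mod_self]
      split_ifs <;> omega
  · rw [List.formPerm_apply_of_notMem]
    · split_ifs <;> omega
    · simp only [hL, List.mem_ofFn]
      rintro ⟨j, rfl⟩
      have := j.2
      simp at hx
      omega

theorem cyc4_eq_cycleIcc {n k : ℕ} (hk : k < n) (i : Fin (k + 1)) :
    cyc4 n k i = Fin.cycleIcc ⟨i, by omega⟩ ⟨k, hk⟩ := by
  have hi := i.2
  have : NeZero n := ⟨by omega⟩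
  ext x
  rw [cyc4_apply_val hk]
  by_cases h₁ : (x : ℕ) < i
  · rw [Fin.cycleIcc_of_lt (by simpa [Fin.lt_def] using h₁), if_pos h₁]
  by_cases h₂ : k < (x : ℕ)
  · rw [Fin.cycleIcc_of_gt (by simpa [Fin.lt_def] using h₂)]
    split_ifs <;> omega
  rw [Fin.cycleIcc_of_le_of_le (by simp [Fin.le_def]; omega) (by simp [Fin.le_def]; omega)]
  by_cases h₃ : (x : ℕ) = k
  · simp [Fin.ext_iff, h₃]
    omega
  · have hn : (x : ℕ) + 1 < n := by omega
    rw [if_neg h₁, if_pos (by omega), if_neg (by simpa [Fin.ext_iff] using h₃),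
      Fin.val_add_one_of_lt' hn]

theorem sign_cyc4 {n k : ℕ} (hk : k < n) (i : Fin (k + 1)) :
    Perm.sign (cyc4 n k i) = (-1) ^ (k - (i : ℕ)) := by
  rw [cyc4_eq_cycleIcc hk, Fin.sign_cycleIcc_of_le]
  exact Nat.lt_succ_iff.mp i.2

theorem mul_cyc4_mem_S₄mid {n k : ℕ} (hk : k < n) {σ : Perm (Fin n)} (hσ : σ ∈ S₄big n k)
    (i : Fin (k + 1)) : σ * cyc4 n k i ∈ S₄mid n k := by
  have hi := i.2
  refine ⟨fun p q hpq hq => hσ.1 _ _ ?_ ?_, fun p q hpq hp => hσ.2 _ _ ?_ ?_⟩ <;>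
  simp only [Fin.lt_def, cyc4_apply_val hk] at * <;>
  split_ifs <;> omega

/-- With `not_lt` in both directions, `σ * cyc4 n k i` determines the cycle index `i`. -/
theorem not_lt_of_mul_cyc4_eq {n k : ℕ} (hk : k < n) {σ σ' : Perm (Fin n)}
    (hσ : σ ∈ S₄big n k) (hσ' : σ' ∈ S₄big n k) {i j : Fin (k + 1)}
    (h : σ * cyc4 n k i = σ' * cyc4 n k j) : ¬ i < j := by
  intro hij
  have hj := j.2
  rw [Fin.lt_def] at hij
  have hI := DFunLike.congr_fun h (⟨i, by omega⟩ : Fin n)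
  have hK := DFunLike.congr_fun h (⟨k, hk⟩ : Fin n)
  simp only [Perm.mul_apply] at hI hK
  have h₁ : σ (cyc4 n k i ⟨k, hk⟩) < σ (cyc4 n k i ⟨i, by omega⟩) := by
    apply hσ.1 <;> simp only [Fin.lt_def, cyc4_apply_val hk] <;> split_ifs <;> omega
  have h₂ : σ' (cyc4 n k j ⟨i, by omega⟩) < σ' (cyc4 n k j ⟨k, hk⟩) := by
    apply hσ'.1 <;> simp only [Fin.lt_def, cyc4_apply_val hk] <;> split_ifs <;> omega
  rw [hI, hK] at h₁
  exact lt_asymm h₁ h₂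

theorem exists_mul_cyc4_eq {n k : ℕ} (hk : k < n) {τ : Perm (Fin n)} (hτ : τ ∈ S₄mid n k) :
    ∃ σ ∈ S₄big n k, ∃ i : Fin (k + 1), σ * cyc4 n k i = τ := by
  have hex : ∃ m, ∃ h : m < n, τ ⟨k, hk⟩ ≤ τ ⟨m, h⟩ := ⟨k, hk, le_rfl⟩
  classical
  obtain ⟨i, ⟨hin, hi⟩, hmin⟩ : ∃ i, (∃ h : i < n, τ ⟨k, hk⟩ ≤ τ ⟨i, h⟩) ∧
      ∀ m < i, ¬ ∃ h : m < n, τ ⟨k, hk⟩ ≤ τ ⟨m, h⟩ :=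
    ⟨Nat.find hex, Nat.find_spec hex, fun m => Nat.find_min hex⟩
  have hik : i ≤ k := by
    by_contra! h
    exact hmin k h ⟨hk, le_rfl⟩
  have hlow : ∀ a b : Fin n, (a : ℕ) < i → (b : ℕ) = k → τ a < τ b := by
    rintro a ⟨b, hb⟩ ha rfl
    by_contra! h
    exact hmin a ha ⟨a.2, h⟩
  have hhigh : ∀ a b : Fin n, (a : ℕ) = k → i ≤ (b : ℕ) → (b : ℕ) < k → τ a < τ b := by
    rintro ⟨a, ha⟩ b rfl hb hbk
    refine lt_of_le_of_ne ?_ fun h => ?_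
    · rcases hb.eq_or_lt with h | h
      · subst h
        exact hi
      · exact hi.trans (hτ.1 ⟨i, hin⟩ b h hbk).le
    · have := congrArg Fin.val (τ.injective h)
      exact hbk.ne this.symm
  set c := cyc4 n k ⟨i, by omega⟩ with hc
  have hval := cyc4_apply_val hk (⟨i, by omega⟩ : Fin (k + 1))
  rw [← hc] at hval
  refine ⟨τ * c⁻¹, ⟨fun p q => ?_, fun p q => ?_⟩, ⟨i, by omega⟩, by simp [← hc]⟩
  · obtain ⟨a, rfl⟩ := c.surjective p
    obtain ⟨b, rfl⟩ := c.surjective q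
    simp only [Perm.mul_apply, Perm.inv_def, symm_apply_apply]
    intro hpq hq
    have ha := hval a
    have hb := hval b
    rw [Fin.lt_def] at hpq
    simp only at ha hb
    by_cases hbk : (b : ℕ) = k
    · exact hlow a b (by split_ifs at ha hb <;> omega) hbk
    by_cases hak : (a : ℕ) = k
    · exact hhigh a b hak (by split_ifs at ha hb <;> omega) (by split_ifs at ha hb <;> omega)
    · apply hτ.1 a b <;> try rw [Fin.lt_def]
      all_goals split_ifs at ha hb <;> omega
  · obtain ⟨a, rfl⟩ := c.surjective p
    obtain ⟨b, rfl⟩ := c.surjective q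
    simp only [Perm.mul_apply, Perm.inv_def, symm_apply_apply]
    intro hpq hp
    have ha := hval a
    have hb := hval b
    rw [Fin.lt_def] at hpq
    simp only at ha hb
    apply hτ.2 a b <;> try rw [Fin.lt_def]
    all_goals split_ifs at ha hb <;> omega

/-- A permutation in `S_{k+1,m}` is determined by the set of its first `k+1` values, which is
arbitrary of size `k+1`. -/
theorem ncard_S₄big_add (k m : ℕ) : (S₄big (k + 1 + m) k).ncard = (k + 1 + m).choose (k + 1) := by
  have hcompl : ∀ s : Finset (Fin (k + 1 + m)), s.card = k + 1 → sᶜ.card = m := fun s hs => by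
    rw [Finset.card_compl, Fintype.card_fin, hs]
    omega
  have hcard : (k + 1 + m).choose (k + 1) =
      ((Finset.univ.powersetCard (k + 1) : Finset (Finset (Fin (k + 1 + m)))) :
        Set (Finset (Fin (k + 1 + m)))).ncard := by
    rw [Set.ncard_coe_finset, Finset.card_powersetCard, Finset.card_univ, Fintype.card_fin]
  have hmono : ∀ σ ∈ S₄big (k + 1 + m) k, StrictMono (fun a : Fin (k + 1) => σ (a.castAdd m)) ∧
      StrictMono (fun b : Fin m => σ (b.natAdd (k + 1))) := fun σ hσ =>
    ⟨fun a b hab => hσ.1 _ _ (Fin.lt_def.mpr (by simpa using hab)) (by simp; omega),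
      fun a b hab => hσ.2 _ _ (Fin.lt_def.mpr (by simpa using hab)) (by simp)⟩
  rw [hcard]
  refine Set.ncard_congr
    (fun σ _ => Finset.univ.image fun a : Fin (k + 1) => σ (a.castAdd m)) ?_ ?_ ?_
  · intro σ _
    simp only [Finset.mem_coe, Finset.mem_powersetCard, Finset.subset_univ, true_and]
    rw [Finset.card_image_of_injective _ fun a b hab => by simpa using hab]
    simp
  · intro σ σ' hσ hσ' heq
    have hs : (Finset.univ.image fun a : Fin (k + 1) => σ (a.castAdd m)).card = k + 1 := by
      rw [Finset.card_image_of_injective _ fun a b hab => by simpa using hab]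
      simp
    set s := Finset.univ.image fun a : Fin (k + 1) => σ (a.castAdd m) with hs_def
    have hmem : ∀ ρ : Perm (Fin (k + 1 + m)),
        s = Finset.univ.image (fun a : Fin (k + 1) => ρ (a.castAdd m)) →
        (∀ a : Fin (k + 1), ρ (a.castAdd m) ∈ s) ∧ ∀ b : Fin m, ρ (b.natAdd (k + 1)) ∈ sᶜ := by
      rintro ρ h
      rw [h]
      refine ⟨fun a => by simp, fun b => ?_⟩
      simp only [Finset.mem_compl, Finset.mem_image, Finset.mem_univ, true_and, not_exists,
        EmbeddingLike.apply_eq_iff_eq, Fin.ext_iff, Fin.val_castAdd, Fin.val_natAdd]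
      omega
    have hleft := (Finset.orderEmbOfFin_unique hs (hmem σ hs_def).1 (hmono σ hσ).1).trans
      (Finset.orderEmbOfFin_unique hs (hmem σ' heq).1 (hmono σ' hσ').1).symm
    have hright :=
      (Finset.orderEmbOfFin_unique (hcompl s hs) (hmem σ hs_def).2 (hmono σ hσ).2).trans
        (Finset.orderEmbOfFin_unique (hcompl s hs) (hmem σ' heq).2 (hmono σ' hσ').2).symm
    refine Equiv.ext fun x => ?_
    induction x using Fin.addCases with
    | left a => exact congrFun hleft a
    | right b => exact congrFun hright b
  · intro s hs
    have hs : s.card = k + 1 := by simpa [Finset.mem_powersetCard] using hs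
    let σ : Perm (Fin (k + 1 + m)) :=
      finSumFinEquiv.symm.trans (finSumEquivOfFinset hs (hcompl s hs))
    have hl : ∀ a : Fin (k + 1), σ (a.castAdd m) = s.orderEmbOfFin hs a := fun a => by simp [σ]
    have hr : ∀ b : Fin m, σ (b.natAdd (k + 1)) = sᶜ.orderEmbOfFin (hcompl s hs) b :=
      fun b => by simp [σ]
    refine ⟨σ, ⟨fun p q => ?_, fun p q => ?_⟩, ?_⟩
    · intro hpq hbound
      rw [Fin.lt_def] at hpq
      induction p using Fin.addCases <;> induction q using Fin.addCases <;>
        simp only [hl, hr, Fin.val_castAdd, Fin.val_natAdd] at hpq hbound ⊢ <;>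
        first
        | omega
        | exact OrderEmbedding.strictMono _ (Fin.lt_def.mpr (by omega))
    · intro hpq hbound
      rw [Fin.lt_def] at hpq
      induction p using Fin.addCases <;> induction q using Fin.addCases <;>
        simp only [hl, hr, Fin.val_castAdd, Fin.val_natAdd] at hpq hbound ⊢ <;>
        first
        | omega
        | exact OrderEmbedding.strictMono _ (Fin.lt_def.mpr (by omega))
    · simp only [hl]
      ext x
      simp

theorem ncard_S₄big {n k : ℕ} (hk : k < n) : (S₄big n k).ncard = n.choose (k + 1) := by
  obtain ⟨m, rfl⟩ := Nat.exists_eq_add_of_le (Nat.succ_le_of_lt hk)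
  exact ncard_S₄big_add k m

/-- for `0 ≤ k ≤ n−1`, the map `(σ, i) ↦ τ = σ ∘ (i, i+1, …, k+1)` is a
well-defined bijection from `S_{k+1,n−k−1} × {1,…,k+1}` onto `S_{k,1,n−k−1}`, the signs
satisfy `ε(τ) = (−1)^{k+1−i} ε(σ)`, and both sets have cardinality `(n choose k)·(n−k)`. -/
theorem bijection_Skplus1_to_Sk1
    (n k : ℕ) (hk : k + 1 ≤ n) :
    (∀ σ ∈ S₄big n k, ∀ i : Fin (k + 1), σ * cyc4 n k i ∈ S₄mid n k) ∧
    Set.BijOn (fun p : Equiv.Perm (Fin n) × Fin (k + 1) => p.1 * cyc4 n k p.2)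
      (S₄big n k ×ˢ (Set.univ : Set (Fin (k + 1)))) (S₄mid n k) ∧
    (∀ σ : Equiv.Perm (Fin n), ∀ i : Fin (k + 1),
      Equiv.Perm.sign (σ * cyc4 n k i) = (-1) ^ (k - (i : ℕ)) * Equiv.Perm.sign σ) ∧
    Nat.card (S₄big n k ×ˢ (Set.univ : Set (Fin (k + 1))) : Set _)
      = n.choose k * (n - k) ∧
    Nat.card (S₄mid n k) = n.choose k * (n - k) := by
  have hbij : Set.BijOn (fun p : Perm (Fin n) × Fin (k + 1) => p.1 * cyc4 n k p.2)
      (S₄big n k ×ˢ (Set.univ : Set (Fin (k + 1)))) (S₄mid n k) := by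
    refine ⟨fun p hp => mul_cyc4_mem_S₄mid hk hp.1 p.2, ?_, ?_⟩
    · rintro ⟨σ, i⟩ ⟨hσ, -⟩ ⟨σ', j⟩ ⟨hσ', -⟩ h
      obtain rfl : i = j := le_antisymm
        (not_lt.mp (not_lt_of_mul_cyc4_eq hk hσ' hσ h.symm))
        (not_lt.mp (not_lt_of_mul_cyc4_eq hk hσ hσ' h))
      exact Prod.ext (mul_right_cancel h) rfl
    · intro τ hτ
      obtain ⟨σ, hσ, i, h⟩ := exists_mul_cyc4_eq hk hτ
      exact ⟨(σ, i), ⟨hσ, Set.mem_univ i⟩, h⟩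
  have hcard : Nat.card (S₄big n k ×ˢ (Set.univ : Set (Fin (k + 1))) : Set _)
      = n.choose k * (n - k) := by
    rw [Nat.card_coe_set_eq, Set.ncard_prod, ncard_S₄big hk, Set.ncard_univ, Nat.card_fin,
      Nat.choose_succ_right_eq]
  refine ⟨fun σ hσ i => mul_cyc4_mem_S₄mid hk hσ i, hbij, fun σ i => ?_, hcard, ?_⟩
  · rw [Perm.sign_mul, sign_cyc4 hk, mul_comm]
  · rw [← hcard]
    exact (Nat.card_congr hbij.equiv).symm
end

section
/- (Proposition: sign-commutation of the comparison diagram.) With L^k = Hom_ℂ(Λ_Q^kV, U) endowed with the differential D, and {}_σU ⊗ (Λ_Q^kV)' endowed with the differential Δ, and with Φ_{3,k} : {}_σU ⊗ (Λ_Q^kV)' → Hom_ℂ(Λ_Q^kV, U) the linear isomorphism Φ_{3,k}(a ⊗ φ)(v_{i_1}∧⋯∧v_{i_k}) = φ(v_{i_1}∧⋯∧v_{i_k})·a, one has Φ_{3,k+1} ∘ Δ = (−1)^{k+1} D ∘ Φ_{3,k} for every k with 0 ≤ k ≤ n−1. -/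
open TensorProduct

noncomputable section

set_option maxHeartbeats 1000000
set_option synthInstance.maxHeartbeats 400000

/-- The defining relations `v_i v_j = q_{ij} v_j v_i` of quantum affine space. -/
def qRel {n : ℕ} (q : Fin n → Fin n → ℂ) :
    FreeAlgebra ℂ (Fin n) → FreeAlgebra ℂ (Fin n) → Prop := fun x y =>
  ∃ i j, x = FreeAlgebra.ι ℂ i * FreeAlgebra.ι ℂ j ∧
    y = q i j • (FreeAlgebra.ι ℂ j * FreeAlgebra.ι ℂ i)

/-- The quantum affine space `U = S_Q V`. -/
abbrev Uq {n : ℕ} (q : Fin n → Fin n → ℂ) : Type := RingQuot (qRel q)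

/-- The generators `v_i` of `U`. -/
def gen {n : ℕ} (q : Fin n → Fin n → ℂ) (i : Fin n) : Uq q :=
  RingQuot.mkAlgHom ℂ (qRel q) (FreeAlgebra.ι ℂ i)

/-- `p_i = ∏_j q_{ji}`. -/
def pcoef {n : ℕ} (q : Fin n → Fin n → ℂ) (i : Fin n) : ℂ := ∏ j : Fin n, q j i

/-- Model of `(Λ_Q^j V)'`: the span of the dual basis `(v_{i_1}∧⋯∧v_{i_j})'`,
indexed by subsets of cardinality `j`. -/
abbrev DualLam (n j : ℕ) : Type := {s : Finset (Fin n) // s.card = j} → ℂ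

/-- Model of `L^j = Hom_ℂ(Λ_Q^j V, U)`: a homomorphism is recorded by its values on
the basis wedges `v_{i_1}∧⋯∧v_{i_j}`, `i_1<⋯<i_j`. -/
abbrev HomLam {n : ℕ} (q : Fin n → Fin n → ℂ) (j : ℕ) : Type :=
  {s : Finset (Fin n) // s.card = j} → Uq q

/-- The dual basis vector `(v_{i_1}∧⋯∧v_{i_j})'` for `S = {i_1<⋯<i_j}`. -/
def dualb {n : ℕ} {j : ℕ} (S : Finset (Fin n)) : DualLam n j :=
  fun T => if T.1 = S then 1 else 0

/-- `Θ_k(i_1,…,i_k) = ∏_{l=1}^{k} ∏_{m < i_l, m ∉ I} (−q_{i_l, m})`. -/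
def Theta {n : ℕ} (q : Fin n → Fin n → ℂ) (I : Finset (Fin n)) : ℂ :=
  ∏ l ∈ I, ∏ m ∈ Finset.univ.filter (fun m => m < l ∧ m ∉ I), (-(q l m))

/-- The differential
`D(φ)(v_{i_1}∧⋯∧v_{i_{k+1}}) = ∑_m (−1)^{m−1} [(∏_{s<m} q_{i_s,i_m}) v_{i_m} φ(…omit v_{i_m}…) −
(∏_{s>m} q_{i_m,i_s}) φ(…omit v_{i_m}…) v_{i_m}]` on `L^* = Hom_ℂ(Λ_Q^*V, U)`. -/
def Dop {n : ℕ} (q : Fin n → Fin n → ℂ) (k : ℕ) (F : HomLam q k) : HomLam q (k + 1) :=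
  fun T => ∑ u : Fin n,
    if hu : u ∈ T.1 then
      (-1 : ℂ) ^ ((T.1.filter (fun w => w < u)).card) •
        ((∏ w ∈ T.1.filter (fun w => w < u), q w u) •
            (gen q u * F ⟨T.1.erase u, by rw [Finset.card_erase_of_mem hu, T.2]; rfl⟩)
         - (∏ w ∈ T.1.filter (fun w => u < w), q u w) •
            (F ⟨T.1.erase u, by rw [Finset.card_erase_of_mem hu, T.2]; rfl⟩ * gen q u))
    else 0

/-- The summand of `Δ` attached to the basis index `I`, as a linear map in the module
element `a`:
`a ↦ Θ_k(I)⁻¹ ∑_{u ∉ I} (−1)^{m−1} [(∏_{w∉I, w<u} q_{w,u}) a v_u − (∏_{w∉I, u<w} q_{u,w}) p_u v_u a] ⊗ Θ_{k+1}(I∪{u}) (v_{I∪{u}})'`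
(where `m−1 = #{w ∉ I : w < u}` is the position of `u` in the complement of `I`). -/
def DeltaTerm {n : ℕ} (q : Fin n → Fin n → ℂ) (k : ℕ)
    (I : {s : Finset (Fin n) // s.card = k}) :
    Uq q →ₗ[ℂ] (Uq q ⊗[ℂ] DualLam n (k + 1)) :=
  (Theta q I.1)⁻¹ •
    ∑ u : Fin n,
      if u ∈ I.1 then 0
      else
        (-1 : ℂ) ^ (((I.1ᶜ).filter (fun w => w < u)).card) •
          (((TensorProduct.mk ℂ (Uq q) (DualLam n (k + 1))).flip
              (Theta q (insert u I.1) • dualb (insert u I.1))).comp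
            ((∏ w ∈ (I.1ᶜ).filter (fun w => w < u), q w u) •
                LinearMap.mulRight ℂ (gen q u)
              - ((∏ w ∈ (I.1ᶜ).filter (fun w => u < w), q u w) * pcoef q u) •
                LinearMap.mulLeft ℂ (gen q u)))

/-- The differential `Δ` on `{}_σU ⊗ (Λ_Q V)'` (formula (6) of the paper), extended
ℂ-linearly from `Δ(a ⊗ (v_{i_1}∧⋯∧v_{i_k})')`. -/
def Delta {n : ℕ} (q : Fin n → Fin n → ℂ) (k : ℕ) :
    (Uq q ⊗[ℂ] DualLam n k) →ₗ[ℂ] (Uq q ⊗[ℂ] DualLam n (k + 1)) :=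
  TensorProduct.lift
    (∑ I : {s : Finset (Fin n) // s.card = k},
      (LinearMap.smulRightₗ (LinearMap.proj I)).comp (DeltaTerm q k I))

/-- The comparison isomorphism `Φ_{3,k} : {}_σU ⊗ (Λ_Q^kV)' → Hom_ℂ(Λ_Q^kV, U)`,
`Φ_{3,k}(a ⊗ φ)(v_{i_1}∧⋯∧v_{i_k}) = φ(v_{i_1}∧⋯∧v_{i_k})·a`. -/
def Phi3 {n : ℕ} (q : Fin n → Fin n → ℂ) (k : ℕ) :
    (Uq q ⊗[ℂ] DualLam n k) →ₗ[ℂ] HomLam q k :=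
  LinearMap.pi fun I =>
    TensorProduct.lift (LinearMap.smulRightₗ (LinearMap.proj I))

theorem Phi3_tmul {n : ℕ} (q : Fin n → Fin n → ℂ) (k : ℕ) (a : Uq q) (φ : DualLam n k)
    (I : {s : Finset (Fin n) // s.card = k}) :
    Phi3 q k (a ⊗ₜ[ℂ] φ) I = φ I • a := by
  simp [Phi3, LinearMap.smulRightₗ]

theorem Dop_add {n : ℕ} (q : Fin n → Fin n → ℂ) (k : ℕ) (F G : HomLam q k) :
    Dop q k (F + G) = Dop q k F + Dop q k G := by
  funext T
  simp only [Dop, Pi.add_apply, ← Finset.sum_add_distrib]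
  refine Finset.sum_congr rfl fun u _ => ?_
  split_ifs
  · rw [mul_add, add_mul]
    module
  · simp

theorem Delta_tmul {n : ℕ} (q : Fin n → Fin n → ℂ) (k : ℕ) (a : Uq q) (φ : DualLam n k) :
    Delta q k (a ⊗ₜ[ℂ] φ) =
      ∑ I : {s : Finset (Fin n) // s.card = k}, φ I • DeltaTerm q k I a := by
  simp [Delta, LinearMap.smulRightₗ]

theorem Theta_ne_zero {n : ℕ} {q : Fin n → Fin n → ℂ} (hq : ∀ i j, q i j * q j i = 1)
    (I : Finset (Fin n)) : Theta q I ≠ 0 :=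
  Finset.prod_ne_zero_iff.2 fun l _ => Finset.prod_ne_zero_iff.2 fun m _ =>
    neg_ne_zero.2 (left_ne_zero_of_mul_eq_one (hq l m))

/-- Adjoining `u` to `I` creates the pairs `(u, m)` with `m ∉ I`, `m < u`, and destroys the
pairs `(l, u)` with `l ∈ I`, `u < l`. -/
theorem Theta_insert {n : ℕ} (q : Fin n → Fin n → ℂ) {I : Finset (Fin n)} {u : Fin n}
    (hu : u ∉ I) :
    Theta q (insert u I) * ∏ l ∈ I with u < l, (-q l u) =
      Theta q I * ∏ m ∈ Iᶜ with m < u, (-q u m) := by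
  have h1 : Finset.univ.filter (fun m => m < u ∧ m ∉ insert u I) =
      Iᶜ.filter (fun m => m < u) := by
    ext m
    simp only [Finset.mem_filter, Finset.mem_univ, true_and, Finset.mem_insert,
      Finset.mem_compl]
    grind
  have h2 : ∀ l ∈ I, (∏ m with m < l ∧ m ∉ insert u I, (-q l m)) *
      (if u < l then -q l u else 1) = ∏ m with m < l ∧ m ∉ I, (-q l m) := by
    intro l _
    split_ifs with h
    · have : Finset.univ.filter (fun m => m < l ∧ m ∉ I) =
          insert u (Finset.univ.filter (fun m => m < l ∧ m ∉ insert u I)) := by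
        ext m
        simp only [Finset.mem_filter, Finset.mem_univ, true_and, Finset.mem_insert]
        grind
      rw [this, Finset.prod_insert (by simp), mul_comm]
    · rw [mul_one]
      refine Finset.prod_congr ?_ fun _ _ => rfl
      ext m
      simp only [Finset.mem_filter, Finset.mem_univ, true_and, Finset.mem_insert]
      grind
  rw [Theta, Theta, Finset.prod_insert hu, h1, Finset.prod_filter (fun l => u < l), mul_assoc,
    ← Finset.prod_mul_distrib, Finset.prod_congr rfl h2, mul_comm]

theorem prod_swap_mul_prod {n : ℕ} {q : Fin n → Fin n → ℂ} (hq : ∀ i j, q i j * q j i = 1)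
    (s : Finset (Fin n)) (u : Fin n) : (∏ w ∈ s, q w u) * ∏ w ∈ s, q u w = 1 := by
  rw [← Finset.prod_mul_distrib]
  exact Finset.prod_eq_one fun w _ => hq w u

theorem card_filter_lt_add_card_filter_gt {n : ℕ} {I : Finset (Fin n)} {u : Fin n}
    (hu : u ∉ I) : (I.filter (fun w => w < u)).card + (I.filter (fun w => u < w)).card = I.card := by
  rw [← Finset.card_filter_add_card_filter_not (s := I) (fun w => w < u)]
  congr 2
  refine Finset.filter_congr fun w hw => ?_
  have : w ≠ u := fun h => hu (h ▸ hw)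
  grind

theorem pcoef_eq {n : ℕ} {q : Fin n → Fin n → ℂ} (hq' : ∀ i, q i i = 1)
    (I : Finset (Fin n)) (u : Fin n) :
    pcoef q u = ((∏ w ∈ I with w < u, q w u) * ∏ w ∈ I with u < w, q w u) *
      ((∏ w ∈ Iᶜ with w < u, q w u) * ∏ w ∈ Iᶜ with u < w, q w u) := by
  rw [pcoef, ← Finset.prod_mul_prod_compl I]
  have key : ∀ s : Finset (Fin n), ∏ w ∈ s, q w u =
      (∏ w ∈ s with w < u, q w u) * ∏ w ∈ s with u < w, q w u := by
    intro s
    rw [Finset.prod_filter, Finset.prod_filter, ← Finset.prod_mul_distrib]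
    refine Finset.prod_congr rfl fun w _ => ?_
    rcases lt_trichotomy w u with h | h | h
    · simp [h, h.not_gt]
    · simp [h, hq']
    · simp [h, h.not_gt]
  rw [key I, key Iᶜ]

/-- The ratio `Θ(I ∪ {u}) / Θ(I)`, with the sign of `u` in the complement of `I` absorbed. -/
theorem Theta_ratio {n : ℕ} {q : Fin n → Fin n → ℂ} (hq : ∀ i j, q i j * q j i = 1)
    {I : Finset (Fin n)} {u : Fin n} (hu : u ∉ I) :
    (Theta q I)⁻¹ * ((-1) ^ (Iᶜ.filter (fun w => w < u)).card * Theta q (insert u I)) =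
      (-1) ^ I.card * (-1) ^ (I.filter (fun w => w < u)).card *
        ((∏ w ∈ Iᶜ with w < u, q u w) * ∏ w ∈ I with u < w, q u w) := by
  have hT := Theta_insert q hu
  have h0 := Theta_ne_zero hq I
  have hA := prod_swap_mul_prod hq (I.filter (fun w => u < w)) u
  rw [Finset.prod_neg, Finset.prod_neg] at hT
  rw [← card_filter_lt_add_card_filter_gt hu]
  set a := (Iᶜ.filter (fun w => w < u)).card
  set b := (I.filter (fun w => u < w)).card
  set c := (I.filter (fun w => w < u)).card
  have sq : ∀ m : ℕ, ((-1 : ℂ) ^ m) * (-1) ^ m = 1 := fun m => by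
    rw [← mul_pow]; simp
  have ha := sq a
  have hb := sq b
  have hc := sq c
  rw [inv_mul_eq_iff_eq_mul₀ h0, pow_add]
  generalize (-1 : ℂ) ^ a = x at *
  generalize (-1 : ℂ) ^ b = y at *
  generalize (-1 : ℂ) ^ c = z at *
  generalize (∏ w ∈ I with u < w, q w u) = P at *
  generalize (∏ w ∈ I with u < w, q u w) = R at *
  generalize (∏ w ∈ Iᶜ with w < u, q u w) = S at *
  generalize Theta q I = t at *
  generalize Theta q (insert u I) = t' at *
  linear_combination (x * y * R) * hT - x * t' * hb - x * t' * y * y * hA + t * S * y * R * ha -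
    t * S * y * R * hc

/-- The coefficients of `Δ` from `I` to `I ∪ {u}` agree with those of `D` up to
`(-1) ^ (|I| + 1)`. -/
theorem Delta_coeff {n : ℕ} {q : Fin n → Fin n → ℂ} (hq : ∀ i j, q i j * q j i = 1)
    (hq' : ∀ i, q i i = 1) {I : Finset (Fin n)} {u : Fin n} (hu : u ∉ I) (a : Uq q) :
    (Theta q I)⁻¹ • ((-1 : ℂ) ^ (Iᶜ.filter (fun w => w < u)).card • (Theta q (insert u I) •
      ((∏ w ∈ Iᶜ with w < u, q w u) • (a * gen q u) -
        ((∏ w ∈ Iᶜ with u < w, q u w) * pcoef q u) • (gen q u * a)))) =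
    (-1 : ℂ) ^ (I.card + 1) • ((-1 : ℂ) ^ (I.filter (fun w => w < u)).card •
      ((∏ w ∈ I with w < u, q w u) • (gen q u * a) -
        (∏ w ∈ I with u < w, q u w) • (a * gen q u))) := by
  have h1 := prod_swap_mul_prod hq (Iᶜ.filter (fun w => w < u)) u
  have h2 := prod_swap_mul_prod hq (Iᶜ.filter (fun w => u < w)) u
  have h3 := prod_swap_mul_prod hq (I.filter (fun w => u < w)) u
  rw [smul_smul, smul_smul, mul_assoc, Theta_ratio hq hu, pcoef_eq hq' I u, pow_succ]
  generalize (-1 : ℂ) ^ I.card = x at *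
  generalize (-1 : ℂ) ^ (I.filter (fun w => w < u)).card = y at *
  generalize (∏ w ∈ Iᶜ with w < u, q w u) = A at *
  generalize (∏ w ∈ Iᶜ with w < u, q u w) = A' at *
  generalize (∏ w ∈ Iᶜ with u < w, q w u) = B at *
  generalize (∏ w ∈ Iᶜ with u < w, q u w) = B' at *
  generalize (∏ w ∈ I with u < w, q w u) = C at *
  generalize (∏ w ∈ I with u < w, q u w) = C' at *
  generalize (∏ w ∈ I with w < u, q w u) = E at *
  have h4 : (A * A') * (B * B') * (C * C') = 1 := by rw [h1, h2, h3, one_mul, one_mul]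
  match_scalars
  · linear_combination (x * y * C') * h1
  · linear_combination (-(x * y * E)) * h4

theorem Phi3_DeltaTerm {n : ℕ} (q : Fin n → Fin n → ℂ) (k : ℕ)
    (I : {s : Finset (Fin n) // s.card = k}) (a : Uq q)
    (T : {s : Finset (Fin n) // s.card = k + 1}) :
    Phi3 q (k + 1) (DeltaTerm q k I a) T =
      ∑ u : Fin n, if u ∉ I.1 ∧ T.1 = insert u I.1 then
        (Theta q I.1)⁻¹ • ((-1 : ℂ) ^ (I.1ᶜ.filter (fun w => w < u)).card •
          (Theta q (insert u I.1) •
            ((∏ w ∈ I.1ᶜ with w < u, q w u) • (a * gen q u) -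
              ((∏ w ∈ I.1ᶜ with u < w, q u w) * pcoef q u) • (gen q u * a)))) else 0 := by
  rw [DeltaTerm, LinearMap.smul_apply, LinearMap.sum_apply, map_smul, map_sum, Pi.smul_apply,
    Finset.sum_apply, Finset.smul_sum]
  refine Finset.sum_congr rfl fun u _ => ?_
  by_cases hu : u ∈ I.1
  · simp [hu]
  · rw [if_neg hu, LinearMap.smul_apply, map_smul, Pi.smul_apply, LinearMap.comp_apply,
      LinearMap.flip_apply, TensorProduct.mk_apply, Phi3_tmul]
    by_cases hT : T.1 = insert u I.1
    · simp [hu, hT, dualb]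
    · simp [hu, hT, dualb]

/-- sign-commutation of the comparison diagram: for `0 ≤ k ≤ n−1`,
`Φ_{3,k+1} ∘ Δ = (−1)^{k+1} D ∘ Φ_{3,k}`. -/
theorem phi3_delta_eq_sign_D_phi3
    (n : ℕ) (q : Fin n → Fin n → ℂ)
    (hq : ∀ i j, q i j * q j i = 1) (hq' : ∀ i, q i i = 1)
    (k : ℕ) (hk : k + 1 ≤ n) :
    ∀ x : Uq q ⊗[ℂ] DualLam n k,
      Phi3 q (k + 1) (Delta q k x) = (-1 : ℂ) ^ (k + 1) • Dop q k (Phi3 q k x) := by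
  intro x
  induction x using TensorProduct.induction_on with
  | zero =>
    have h0 : Dop q k 0 = 0 := by simpa using Dop_add q k 0 0
    simp [h0]
  | add x y hx hy => rw [map_add, map_add, map_add, hx, hy, Dop_add, smul_add]
  | tmul a φ =>
    funext T
    rw [Delta_tmul, map_sum, Finset.sum_apply, Pi.smul_apply, Dop, Finset.smul_sum]
    simp only [map_smul, Pi.smul_apply, Phi3_DeltaTerm, Finset.smul_sum]
    rw [Finset.sum_comm]
    refine Finset.sum_congr rfl fun u _ => ?_
    by_cases hu : u ∈ T.1
    · have hcard : (T.1.erase u).card = k := by rw [Finset.card_erase_of_mem hu, T.2]; rfl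
      have hlt : T.1.filter (fun w => w < u) = (T.1.erase u).filter (fun w => w < u) := by
        ext w; simp only [Finset.mem_filter, Finset.mem_erase]; grind
      have hgt : T.1.filter (fun w => u < w) = (T.1.erase u).filter (fun w => u < w) := by
        ext w; simp only [Finset.mem_filter, Finset.mem_erase]; grind
      rw [dif_pos hu, Finset.sum_eq_single ⟨T.1.erase u, hcard⟩]
      · rw [if_pos ⟨Finset.notMem_erase u T.1, (Finset.insert_erase hu).symm⟩,
          Delta_coeff hq hq' (Finset.notMem_erase u T.1), Phi3_tmul, hlt, hgt, hcard,
          mul_smul_comm, smul_mul_assoc]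
        module
      · intro I _ hI
        rw [if_neg, smul_zero]
        rintro ⟨h1, h2⟩
        exact hI (Subtype.ext (by simp [h2, Finset.erase_insert h1]))
      · simp
    · rw [dif_neg hu, smul_zero]
      refine Finset.sum_eq_zero fun I _ => ?_
      rw [if_neg, smul_zero]
      rintro ⟨-, h⟩
      exact hu (h ▸ Finset.mem_insert_self u I.1)
end
end
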